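/- Every Lévy measure F on a separable Banach space B satisfies, for each ε > 0, sup_{‖y*‖ ≤ 1} ∫ 1_{{‖x‖ ≤ 1}} |⟨x, y*⟩|² F(dx) + F({z ∈ B : ‖z‖ ≥ ε}) < ∞, where the supremum is over y* in the closed unit ball of the dual B*. In particular, a measure F on ℝ^d with F({0}) = 0 is a Lévy measure if and only if ∫ (1 ∧ ‖x‖²) F(dx) < ∞. -/

import Mathlib

open MeasureTheory
open scoped ENNReal

/-- The integrand of the Lévy–Khinchine exponent of a (compound-Poisson-type) infinitely
divisible law with Lévy measure `ν`, in direction `L ∈ B*` (with truncation `1_{‖x‖≤1}`). -/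
noncomputable def levyIntegrand {B : Type*} [NormedAddCommGroup B] [NormedSpace ℝ B]
    (L : B →L[ℝ] ℝ) (x : B) : ℂ :=
  Complex.exp (Complex.I * (L x : ℂ)) - 1 -
    Complex.I * (L x : ℂ) * ({x : B | ‖x‖ ≤ 1}.indicator (fun _ => (1 : ℝ)) x : ℂ)

/-- `ν` is a Lévy measure on `B`: `ν({0}) = 0` and the Lévy–Khinchine exponent built from
`ν` (with zero Gaussian part and zero drift) is the characteristic functional of a
probability measure on `B`, i.e. `ν` is the jump intensity measure of an infinitely
divisible distribution on `B`. -/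
def IsLevyMeasure {B : Type*} [NormedAddCommGroup B] [NormedSpace ℝ B]
    [MeasurableSpace B] (ν : Measure B) : Prop :=
  ν {0} = 0 ∧
  ∃ μ : Measure B, IsProbabilityMeasure μ ∧
    ∀ L : B →L[ℝ] ℝ,
      Integrable (levyIntegrand L) ν ∧
      ∫ y, Complex.exp (Complex.I * (L y : ℂ)) ∂μ
        = Complex.exp (∫ x, levyIntegrand L x ∂ν)

set_option linter.unusedSectionVars false
open Filter Topology

section LevyAux

variable {B : Type*} [NormedAddCommGroup B] [NormedSpace ℝ B] [MeasurableSpace B]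

lemma levy_re (L : B →L[ℝ] ℝ) (x : B) : (levyIntegrand L x).re = Real.cos (L x) - 1 := by
  unfold levyIntegrand
  have h : Complex.exp (Complex.I * (L x : ℂ)) = Complex.cos (L x) + Complex.sin (L x) * Complex.I := by
    rw [mul_comm, Complex.exp_mul_I]
  rw [h, ← Complex.ofReal_cos, ← Complex.ofReal_sin]
  by_cases hx : ‖x‖ ≤ 1 <;> simp [hx, -Complex.ofReal_cos, -Complex.ofReal_sin]

lemma levy_cos_integrable {ν : Measure B} {L : B →L[ℝ] ℝ} (h : Integrable (levyIntegrand L) ν) :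
    Integrable (fun x => 1 - Real.cos (L x)) ν := by
  have := h.re.neg
  refine this.congr (ae_of_all _ fun x => ?_)
  simp [levy_re]

lemma levy_integral_re {ν : Measure B} {L : B →L[ℝ] ℝ} (h : Integrable (levyIntegrand L) ν) :
    (∫ x, levyIntegrand L x ∂ν).re = - ∫ x, (1 - Real.cos (L x)) ∂ν := by
  have h1 : (∫ x, levyIntegrand L x ∂ν).re = ∫ x, (levyIntegrand L x).re ∂ν := (integral_re h).symm
  rw [h1, ← integral_neg]
  congr 1; ext x; rw [levy_re]; ring

lemma levy_unif [OpensMeasurableSpace B] {ν μ : Measure B} [IsProbabilityMeasure μ]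
    (h : ∀ L : B →L[ℝ] ℝ, Integrable (levyIntegrand L) ν ∧
      ∫ y, Complex.exp (Complex.I * (L y : ℂ)) ∂μ = Complex.exp (∫ x, levyIntegrand L x ∂ν)) :
    ∃ δ : ℝ, 0 < δ ∧ ∀ L : B →L[ℝ] ℝ, ‖L‖ ≤ δ → ∫ x, (1 - Real.cos (L x)) ∂ν ≤ Real.log 2 := by
  have ht : Tendsto (fun n : ℕ => ∫ y, min 2 ((1 / ((n : ℝ) + 1)) * ‖y‖) ∂μ) atTop
      (𝓝 (∫ _y, (0 : ℝ) ∂μ)) := by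
    refine tendsto_integral_of_dominated_convergence (fun _ => 2) ?_ (integrable_const _) ?_ ?_
    · intro n
      exact Measurable.aestronglyMeasurable (by fun_prop)
    · intro n
      refine ae_of_all _ fun y => ?_
      rw [Real.norm_of_nonneg (by positivity)]
      exact min_le_left _ _
    · refine ae_of_all _ fun y => ?_
      have h1 : Tendsto (fun n : ℕ => (1 / ((n : ℝ) + 1)) * ‖y‖) atTop (𝓝 (0 * ‖y‖)) :=
        tendsto_one_div_add_atTop_nhds_zero_nat.mul_const _
      have h2 := (tendsto_const_nhds (x := (2 : ℝ))).min h1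
      simpa using h2
  rw [integral_zero] at ht
  obtain ⟨n, hn⟩ := (ht.eventually (gt_mem_nhds (show (0 : ℝ) < 1 / 2 by norm_num))).exists
  refine ⟨1 / ((n : ℝ) + 1), by positivity, fun L hL => ?_⟩
  have hIntg : Integrable (fun y => Complex.exp (Complex.I * (L y : ℂ))) μ := by
    refine (integrable_const (1 : ℝ)).mono (Measurable.aestronglyMeasurable (by fun_prop)) ?_
    refine ae_of_all _ fun y => ?_
    rw [mul_comm, Complex.norm_exp_ofReal_mul_I]; simp
  have hφ : ‖(∫ y, Complex.exp (Complex.I * (L y : ℂ)) ∂μ) - 1‖ ≤ 1 / 2 := by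
    have e : (∫ y, Complex.exp (Complex.I * (L y : ℂ)) ∂μ) - 1
        = ∫ y, (Complex.exp (Complex.I * (L y : ℂ)) - 1) ∂μ := by
      rw [integral_sub hIntg (integrable_const _)]; simp
    rw [e]
    refine (norm_integral_le_integral_norm _).trans (le_trans ?_ hn.le)
    refine integral_mono_of_nonneg (ae_of_all _ fun _ => norm_nonneg _) ?_ (ae_of_all _ fun y => ?_)
    · refine (integrable_const (2 : ℝ)).mono (Measurable.aestronglyMeasurable (by fun_prop)) (ae_of_all _ fun y => ?_)
      rw [Real.norm_of_nonneg (by positivity)]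
      simp
    · refine le_min ?_ ?_
      · refine (norm_sub_le _ _).trans ?_
        rw [mul_comm, Complex.norm_exp_ofReal_mul_I]; norm_num
      · refine (Real.norm_exp_I_mul_ofReal_sub_one_le).trans ?_
        refine (L.le_opNorm y).trans ?_
        gcongr
  have h3 : 1 / 2 ≤ ‖∫ y, Complex.exp (Complex.I * (L y : ℂ)) ∂μ‖ := by
    have := norm_sub_norm_le (1 : ℂ) (∫ y, Complex.exp (Complex.I * (L y : ℂ)) ∂μ)
    rw [norm_sub_rev, norm_one] at this
    linarith
  rw [(h L).2, Complex.norm_exp, levy_integral_re (h L).1] at h3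
  have h4 := Real.log_le_log (by norm_num) h3
  rw [Real.log_exp, one_div, Real.log_inv] at h4
  linarith

lemma cos_lower {θ : ℝ} (h : |θ| ≤ 1) : θ ^ 2 ≤ 5 * (1 - Real.cos θ) := by
  have h1 := Real.cos_le_one_sub_mul_cos_sq (x := θ) (by linarith [Real.pi_gt_three])
  have h2 : 1 / 5 ≤ 2 / Real.pi ^ 2 := by
    rw [div_le_div_iff₀ (by norm_num) (by positivity)]
    nlinarith [Real.pi_lt_d2, Real.pi_gt_three]
  nlinarith [sq_nonneg θ]

/-- the sup bound -/
lemma levy_sup [OpensMeasurableSpace B] {ν μ : Measure B} [IsProbabilityMeasure μ]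
    (h : ∀ L : B →L[ℝ] ℝ, Integrable (levyIntegrand L) ν ∧
      ∫ y, Complex.exp (Complex.I * (L y : ℂ)) ∂μ = Complex.exp (∫ x, levyIntegrand L x ∂ν)) :
    (⨆ L : {L : B →L[ℝ] ℝ // ‖L‖ ≤ 1},
        ∫⁻ x in {x : B | ‖x‖ ≤ 1}, ENNReal.ofReal ((L.1 x) ^ 2) ∂ν) < ⊤ := by
  obtain ⟨δ', hδ', hb'⟩ := levy_unif h
  obtain ⟨δ, hδ, hδ1, hb⟩ : ∃ δ : ℝ, 0 < δ ∧ δ ≤ 1 ∧ ∀ L : B →L[ℝ] ℝ, ‖L‖ ≤ δ →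
      ∫ x, (1 - Real.cos (L x)) ∂ν ≤ Real.log 2 :=
    ⟨min δ' 1, by positivity, min_le_right _ _, fun L hL => hb' L (hL.trans (min_le_left _ _))⟩
  refine lt_of_le_of_lt (iSup_le (a := ENNReal.ofReal (5 / δ ^ 2) * ENNReal.ofReal (Real.log 2)) ?_)
    (ENNReal.mul_lt_top ENNReal.ofReal_lt_top ENNReal.ofReal_lt_top)
  rintro ⟨L, hL⟩
  have hn : ‖δ • L‖ ≤ δ := by
    rw [norm_smul, Real.norm_of_nonneg hδ.le]; nlinarith
  have key : ∀ x ∈ {x : B | ‖x‖ ≤ 1}, ENNReal.ofReal ((L x) ^ 2) ≤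
      ENNReal.ofReal (5 / δ ^ 2) * ENNReal.ofReal (1 - Real.cos ((δ • L) x)) := by
    intro x hx
    rw [← ENNReal.ofReal_mul (by positivity)]
    apply ENNReal.ofReal_le_ofReal
    have hx1 : |(δ • L) x| ≤ 1 := by
      have := (δ • L).le_opNorm x
      rw [Real.norm_eq_abs] at this
      have hx' : ‖x‖ ≤ 1 := hx
      nlinarith [norm_nonneg x, norm_nonneg (δ • L)]
    have := cos_lower hx1
    have e : (δ • L) x = δ * L x := rfl
    rw [e] at this ⊢
    rw [div_mul_eq_mul_div, le_div_iff₀ (by positivity)]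
    nlinarith
  calc ∫⁻ x in {x : B | ‖x‖ ≤ 1}, ENNReal.ofReal ((L x) ^ 2) ∂ν
      ≤ ∫⁻ x in {x : B | ‖x‖ ≤ 1}, ENNReal.ofReal (5 / δ ^ 2) *
          ENNReal.ofReal (1 - Real.cos ((δ • L) x)) ∂ν :=
        setLIntegral_mono' (measurableSet_le measurable_norm measurable_const) key
    _ ≤ ∫⁻ x, ENNReal.ofReal (5 / δ ^ 2) *
          ENNReal.ofReal (1 - Real.cos ((δ • L) x)) ∂ν := setLIntegral_le_lintegral _ _
    _ = ENNReal.ofReal (5 / δ ^ 2) * ∫⁻ x, ENNReal.ofReal (1 - Real.cos ((δ • L) x)) ∂ν :=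
        lintegral_const_mul' _ _ ENNReal.ofReal_ne_top
    _ ≤ _ := by
        gcongr
        rw [← ofReal_integral_eq_lintegral_ofReal (levy_cos_integrable (h _).1)
          (ae_of_all _ fun x => by simpa using Real.cos_le_one _)]
        exact ENNReal.ofReal_le_ofReal (hb _ hn)

end LevyAux

section LevyOneDim

variable {B : Type*} [NormedAddCommGroup B] [NormedSpace ℝ B] [MeasurableSpace B]

lemma levy_sq_small [OpensMeasurableSpace B] {ν : Measure B} {L : B →L[ℝ] ℝ}
    (h : Integrable (levyIntegrand L) ν) :
    ∫⁻ x in {x : B | |L x| ≤ 1}, ENNReal.ofReal ((L x) ^ 2) ∂ν < ⊤ := by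
  have hm : MeasurableSet {x : B | |L x| ≤ 1} :=
    measurableSet_le (by fun_prop) measurable_const
  calc ∫⁻ x in {x : B | |L x| ≤ 1}, ENNReal.ofReal ((L x) ^ 2) ∂ν
      ≤ ∫⁻ x in {x : B | |L x| ≤ 1}, ENNReal.ofReal (5 * (1 - Real.cos (L x))) ∂ν :=
        setLIntegral_mono' hm fun x hx => ENNReal.ofReal_le_ofReal (cos_lower hx)
    _ ≤ ∫⁻ x, ENNReal.ofReal (5 * (1 - Real.cos (L x))) ∂ν := setLIntegral_le_lintegral _ _
    _ < ⊤ := ((levy_cos_integrable h).const_mul 5).lintegral_lt_top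

lemma one_sub_cos_avg {δ θ : ℝ} (hδ : 0 < δ) (hθ : 2 / δ < |θ|) :
    ENNReal.ofReal (δ / 2) ≤ ∫⁻ t in Set.Ioc 0 δ, ENNReal.ofReal (1 - Real.cos (t * θ)) := by
  have h0 : 0 < |θ| := lt_trans (by positivity) hθ
  have hθ0 : θ ≠ 0 := abs_pos.mp h0
  have hIntg : IntegrableOn (fun t => 1 - Real.cos (t * θ)) (Set.Ioc 0 δ) :=
    (Continuous.integrableOn_Icc (by fun_prop)).mono_set Set.Ioc_subset_Icc_self
  rw [← ofReal_integral_eq_lintegral_ofReal hIntg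
    (ae_of_all _ fun x => by simpa using Real.cos_le_one _)]
  apply ENNReal.ofReal_le_ofReal
  rw [← intervalIntegral.integral_of_le hδ.le]
  have e : ∫ t in (0 : ℝ)..δ, (1 - Real.cos (t * θ)) = δ - θ⁻¹ * Real.sin (δ * θ) := by
    rw [intervalIntegral.integral_sub (by simp) (Continuous.intervalIntegrable (by fun_prop) _ _),
      intervalIntegral.integral_comp_mul_right (fun x => Real.cos x) hθ0]
    simp
  rw [e]
  have h1 : |θ⁻¹ * Real.sin (δ * θ)| ≤ δ / 2 := by
    rw [abs_mul, abs_inv]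
    have h2 : |θ|⁻¹ ≤ δ / 2 := by
      rw [inv_le_comm₀ h0 (by positivity)]
      rw [inv_div]; exact hθ.le
    calc |θ|⁻¹ * |Real.sin (δ * θ)| ≤ |θ|⁻¹ * 1 := by
          gcongr; exact Real.abs_sin_le_one _
      _ ≤ δ / 2 := by simpa using h2
  have := (abs_le.mp h1).2
  linarith

lemma levy_large [OpensMeasurableSpace B] {ν μ : Measure B} [IsProbabilityMeasure μ]
    (h : ∀ L : B →L[ℝ] ℝ, Integrable (levyIntegrand L) ν ∧
      ∫ y, Complex.exp (Complex.I * (L y : ℂ)) ∂μ = Complex.exp (∫ x, levyIntegrand L x ∂ν))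
    (L : B →L[ℝ] ℝ) : ∃ R : ℝ, 0 < R ∧ ν {x | R < |L x|} < ⊤ := by
  obtain ⟨δ', hδ', hb⟩ := levy_unif h
  obtain ⟨δ, hδ, hδL⟩ : ∃ δ : ℝ, 0 < δ ∧ δ * ‖L‖ ≤ δ' := by
    refine ⟨δ' / (‖L‖ + 1), by positivity, ?_⟩
    rw [div_mul_eq_mul_div, div_le_iff₀ (by positivity)]
    nlinarith [norm_nonneg L]
  refine ⟨2 / δ, by positivity, ?_⟩
  set R := 2 / δ with hR
  have hRpos : 0 < R := by positivity
  let T : ℕ → Set B := fun n => {x | R < |L x| ∧ |L x| ≤ (n : ℝ) + 1}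
  have hTm : ∀ n, MeasurableSet (T n) := fun n =>
    MeasurableSet.inter (s₁ := {x | R < |L x|}) (s₂ := {x | |L x| ≤ (n : ℝ) + 1})
      (measurableSet_lt measurable_const (by fun_prop))
      (measurableSet_le (by fun_prop) measurable_const)
  have hTmono : Monotone T := by
    intro m n hmn x hx
    refine ⟨hx.1, hx.2.trans ?_⟩
    have : (m : ℝ) ≤ n := by exact_mod_cast hmn
    linarith
  have hTU : {x | R < |L x|} = ⋃ n, T n := by
    ext x
    simp only [Set.mem_iUnion, T, Set.mem_ofPred_eq]
    constructor
    · intro hx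
      obtain ⟨n, hn⟩ := exists_nat_ge |L x|
      exact ⟨n, hx, by linarith⟩
    · rintro ⟨n, hx, -⟩; exact hx
  have hTfin : ∀ n, ν (T n) < ⊤ := by
    intro n
    have hs := levy_sq_small (h ((1 / ((n : ℝ) + 1)) • L)).1
    have hc : (0 : ℝ) < (1 / ((n : ℝ) + 1) * R) ^ 2 := by positivity
    have hle : ENNReal.ofReal ((1 / ((n : ℝ) + 1) * R) ^ 2) * ν (T n) ≤
        ∫⁻ x in {x : B | |((1 / ((n : ℝ) + 1)) • L) x| ≤ 1},
          ENNReal.ofReal ((((1 / ((n : ℝ) + 1)) • L) x) ^ 2) ∂ν := by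
      rw [← setLIntegral_const]
      refine (setLIntegral_mono' (hTm n) ?_).trans (lintegral_mono_set ?_)
      · intro x hx
        apply ENNReal.ofReal_le_ofReal
        have e : ((1 / ((n : ℝ) + 1)) • L) x = (1 / ((n : ℝ) + 1)) * L x := rfl
        rw [e, ← sq_abs (1 / ((n : ℝ) + 1) * L x), abs_mul, abs_of_pos (show (0 : ℝ) < 1 / ((n : ℝ) + 1) by positivity)]
        have := hx.1
        gcongr
      · intro x hx
        have e : ((1 / ((n : ℝ) + 1)) • L) x = (1 / ((n : ℝ) + 1)) * L x := rfl
        rw [Set.mem_ofPred_eq, e, abs_mul, abs_of_pos (show (0 : ℝ) < 1 / ((n : ℝ) + 1) by positivity),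
          one_div_mul_eq_div, div_le_one (by positivity)]
        exact hx.2
    by_contra hcon
    rw [not_lt, top_le_iff] at hcon
    rw [hcon, ENNReal.mul_top (ENNReal.ofReal_pos.mpr hc).ne'] at hle
    exact absurd hs (not_lt.mpr hle)
  have hTb : ∀ n, ENNReal.ofReal (δ / 2) * ν (T n) ≤
      ENNReal.ofReal (Real.log 2) * ENNReal.ofReal δ := by
    intro n
    have : IsFiniteMeasure (ν.restrict (T n)) := ⟨by simpa using hTfin n⟩
    calc ENNReal.ofReal (δ / 2) * ν (T n) = ∫⁻ x in T n, ENNReal.ofReal (δ / 2) ∂ν := by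
          rw [setLIntegral_const]
      _ ≤ ∫⁻ x in T n, (∫⁻ t in Set.Ioc (0 : ℝ) δ, ENNReal.ofReal (1 - Real.cos (t * L x))) ∂ν :=
          setLIntegral_mono' (hTm n) fun x hx => one_sub_cos_avg hδ hx.1
      _ = ∫⁻ t in Set.Ioc (0 : ℝ) δ, (∫⁻ x in T n, ENNReal.ofReal (1 - Real.cos (t * L x)) ∂ν) := by
          refine lintegral_lintegral_swap (Measurable.aemeasurable ?_)
          have hL : Measurable L := L.measurable
          simp only [Function.uncurry_def]
          fun_prop
      _ ≤ ∫⁻ t in Set.Ioc (0 : ℝ) δ, ENNReal.ofReal (Real.log 2) := by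
          refine setLIntegral_mono' measurableSet_Ioc fun t ht => ?_
          refine (setLIntegral_le_lintegral _ _).trans ?_
          have hc := levy_cos_integrable (h (t • L)).1
          have e : ∀ x, (t • L) x = t * L x := fun x => rfl
          have hn : ‖t • L‖ ≤ δ' := by
            rw [norm_smul, Real.norm_of_nonneg ht.1.le]
            exact (mul_le_mul_of_nonneg_right ht.2 (norm_nonneg _)).trans hδL
          have := hb (t • L) hn
          simp only [e] at hc this
          rw [← ofReal_integral_eq_lintegral_ofReal hc
            (ae_of_all _ fun x => by simpa using Real.cos_le_one _)]
          exact ENNReal.ofReal_le_ofReal this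
      _ = _ := by rw [setLIntegral_const]; simp
  rw [hTU, hTmono.measure_iUnion]
  refine lt_of_le_of_lt (iSup_le (a := ENNReal.ofReal (Real.log 2) * ENNReal.ofReal δ / ENNReal.ofReal (δ / 2)) fun n => ?_) ?_
  · rw [ENNReal.le_div_iff_mul_le (Or.inl (by simpa using hδ)) (Or.inl ENNReal.ofReal_ne_top), mul_comm]
    exact hTb n
  · refine ENNReal.div_lt_top (ENNReal.mul_lt_top ENNReal.ofReal_lt_top ENNReal.ofReal_lt_top).ne ?_
    simpa using hδ

lemma levy_one_dim [OpensMeasurableSpace B] {ν μ : Measure B} [IsProbabilityMeasure μ]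
    (h : ∀ L : B →L[ℝ] ℝ, Integrable (levyIntegrand L) ν ∧
      ∫ y, Complex.exp (Complex.I * (L y : ℂ)) ∂μ = Complex.exp (∫ x, levyIntegrand L x ∂ν))
    (L : B →L[ℝ] ℝ) : ∫⁻ x, ENNReal.ofReal (min 1 ((L x) ^ 2)) ∂ν < ⊤ := by
  obtain ⟨R, hR, hfin⟩ := levy_large h L
  have hm : MeasurableSet {x : B | |(R⁻¹ • L) x| ≤ 1} :=
    measurableSet_le (by fun_prop) measurable_const
  have hs := levy_sq_small (h (R⁻¹ • L)).1
  have e : ∀ x, (R⁻¹ • L) x = R⁻¹ * L x := fun x => rfl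
  have hc : {x : B | |(R⁻¹ • L) x| ≤ 1}ᶜ = {x | R < |L x|} := by
    ext x
    rw [Set.mem_compl_iff, Set.mem_ofPred_eq, Set.mem_ofPred_eq, e, abs_mul, abs_of_pos (inv_pos.mpr hR),
      inv_mul_le_iff₀ hR, mul_one, not_le]
  rw [← lintegral_add_compl _ hm, hc]
  refine ENNReal.add_lt_top.mpr ⟨?_, ?_⟩
  · refine lt_of_le_of_lt (b := ENNReal.ofReal (R ^ 2) * ∫⁻ x in {x : B | |(R⁻¹ • L) x| ≤ 1},
        ENNReal.ofReal (((R⁻¹ • L) x) ^ 2) ∂ν) ?_ (ENNReal.mul_lt_top ENNReal.ofReal_lt_top hs)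
    rw [← lintegral_const_mul' _ _ ENNReal.ofReal_ne_top]
    refine lintegral_mono fun x => ?_
    dsimp only
    rw [← ENNReal.ofReal_mul (by positivity)]
    apply ENNReal.ofReal_le_ofReal
    rw [e, mul_pow, ← mul_assoc, ← mul_pow, mul_inv_cancel₀ hR.ne', one_pow, one_mul]
    exact min_le_right _ _
  · refine lt_of_le_of_lt (b := ∫⁻ x in {x | R < |L x|}, 1 ∂ν) ?_ (by simpa using hfin)
    refine lintegral_mono fun x => ?_
    rw [← ENNReal.ofReal_one]
    exact ENNReal.ofReal_le_ofReal (min_le_left _ _)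

lemma levy_half_fin [OpensMeasurableSpace B] {ν μ : Measure B} [IsProbabilityMeasure μ]
    (h : ∀ L : B →L[ℝ] ℝ, Integrable (levyIntegrand L) ν ∧
      ∫ y, Complex.exp (Complex.I * (L y : ℂ)) ∂μ = Complex.exp (∫ x, levyIntegrand L x ∂ν))
    (L : B →L[ℝ] ℝ) {c : ℝ} (hc : 0 < c) : ν {x | c ≤ |L x|} < ⊤ := by
  have h1 := levy_one_dim h L
  have hε : (0 : ℝ) < min 1 (c ^ 2) := by positivity
  have := meas_ge_le_lintegral_div (μ := ν) (f := fun x => ENNReal.ofReal (min 1 ((L x) ^ 2)))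
    (Measurable.aemeasurable (by fun_prop)) (ε := ENNReal.ofReal (min 1 (c ^ 2)))
    (by simpa using hc.ne') ENNReal.ofReal_ne_top
  refine lt_of_le_of_lt (measure_mono ?_) (lt_of_le_of_lt this
    (ENNReal.div_lt_top h1.ne (by simpa using hc.ne')))
  intro x hx
  apply ENNReal.ofReal_le_ofReal
  have hx' : c ≤ |L x| := hx
  rw [← sq_abs (L x)]
  gcongr

end LevyOneDim

section CompoundPoisson

variable {E : Type*} [NormedAddCommGroup E] [NormedSpace ℝ E] [MeasurableSpace E] [BorelSpace E]
  [SecondCountableTopology E]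

/-- convolution powers -/
noncomputable def cpPow (lam : Measure E) : ℕ → Measure E
  | 0 => Measure.dirac 0
  | n + 1 => lam ∗ cpPow lam n

instance cpPow_fin (lam : Measure E) [IsFiniteMeasure lam] (n : ℕ) :
    IsFiniteMeasure (cpPow lam n) := by
  induction n with
  | zero => unfold cpPow; infer_instance
  | succ n ih => unfold cpPow; infer_instance

lemma cpPow_univ (lam : Measure E) [IsFiniteMeasure lam] (n : ℕ) :
    cpPow lam n Set.univ = lam Set.univ ^ n := by
  induction n with
  | zero => simp [cpPow]
  | succ n ih =>
    rw [cpPow, Measure.conv, Measure.map_apply (by fun_prop) MeasurableSet.univ, Set.preimage_univ,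
      Measure.prod_apply MeasurableSet.univ]
    simp [ih, pow_succ]

lemma cpPow_char (lam : Measure E) [IsFiniteMeasure lam] (n : ℕ) (L : StrongDual ℝ E) :
    charFunDual (cpPow lam n) L = charFunDual lam L ^ n := by
  induction n with
  | zero => simp [cpPow]
  | succ n ih => rw [cpPow, charFunDual_conv, ih, pow_succ']

/-- compound Poisson law -/
noncomputable def cpLaw (lam : Measure E) : Measure E :=
  Measure.sum fun n : ℕ =>
    ENNReal.ofReal (Real.exp (-(lam.real Set.univ)) / (n.factorial : ℝ)) • cpPow lam n

instance cpLaw_prob (lam : Measure E) [IsFiniteMeasure lam] : IsProbabilityMeasure (cpLaw lam) := by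
  constructor
  rw [cpLaw, Measure.sum_apply _ MeasurableSet.univ]
  have h := ProbabilityTheory.hasSum_one_poissonMeasure ⟨lam.real Set.univ, measureReal_nonneg⟩
  change HasSum (fun n : ℕ => Real.exp (-(lam.real Set.univ)) * (lam.real Set.univ) ^ n / (n.factorial : ℝ)) 1 at h
  have e : ∀ n : ℕ, (ENNReal.ofReal (Real.exp (-(lam.real Set.univ)) / (n.factorial : ℝ)) • cpPow lam n)
      Set.univ = ENNReal.ofReal (Real.exp (-(lam.real Set.univ)) * (lam.real Set.univ) ^ n / (n.factorial : ℝ)) := by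
    intro n
    rw [Measure.smul_apply, cpPow_univ, smul_eq_mul, ← ofReal_measureReal (μ := lam) (s := Set.univ),
      ← ENNReal.ofReal_pow measureReal_nonneg, ← ENNReal.ofReal_mul (by positivity)]
    congr 1; ring
  simp_rw [e]
  rw [← ENNReal.ofReal_tsum_of_nonneg (fun n => by positivity) h.summable, h.tsum_eq,
    ENNReal.ofReal_one]

lemma cpLaw_char (lam : Measure E) [IsFiniteMeasure lam] (L : StrongDual ℝ E) :
    charFunDual (cpLaw lam) L = Complex.exp (∫ x, (Complex.exp (Complex.I * (L x : ℂ)) - 1) ∂lam) := by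
  have hIntg : ∀ κ : Measure E, IsFiniteMeasure κ → Integrable (fun x => Complex.exp ((L x : ℂ) * Complex.I)) κ := by
    intro κ _
    refine (integrable_const (1 : ℝ)).mono (Measurable.aestronglyMeasurable (by fun_prop)) ?_
    refine ae_of_all _ fun y => ?_
    rw [Complex.norm_exp_ofReal_mul_I]; simp
  have h1 := hasSum_integral_measure (hIntg (cpLaw lam) inferInstance)
  have h2 : HasSum (fun n : ℕ => (Real.exp (-(lam.real Set.univ)) : ℂ) * (charFunDual lam L ^ n / n.factorial))
      (charFunDual (cpLaw lam) L) := by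
    have e0 : ∀ n : ℕ, (∫ x, Complex.exp ((L x : ℂ) * Complex.I)
        ∂(ENNReal.ofReal (Real.exp (-(lam.real Set.univ)) / (n.factorial : ℝ)) • cpPow lam n))
        = (Real.exp (-(lam.real Set.univ)) : ℂ) * (charFunDual lam L ^ n / n.factorial) := by
      intro n
      rw [integral_smul_measure, ENNReal.toReal_ofReal (by positivity)]
      have e := cpPow_char lam n L
      rw [charFunDual_apply] at e
      rw [e, Complex.real_smul]
      push_cast
      ring
    simp_rw [e0] at h1
    exact h1
  have h3 := (NormedSpace.expSeries_div_hasSum_exp (charFunDual lam L)).mul_left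
    (Real.exp (-(lam.real Set.univ)) : ℂ)
  rw [h2.unique h3, ← Complex.exp_eq_exp_ℂ, Complex.ofReal_exp, ← Complex.exp_add]
  congr 1
  rw [integral_sub (by simpa only [mul_comm] using hIntg lam inferInstance) (integrable_const _), charFunDual_apply]
  simp only [mul_comm Complex.I]
  simp
  ring

lemma cpLaw_ge_self (lam : Measure E) :
    ENNReal.ofReal (Real.exp (-(lam.real Set.univ))) • (lam ∗ Measure.dirac 0) ≤ cpLaw lam := by
  refine le_trans (le_of_eq ?_) (Measure.le_sum _ 1)
  simp [cpPow]

lemma cpLaw_ge_dirac (lam : Measure E) :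
    ENNReal.ofReal (Real.exp (-(lam.real Set.univ))) • (Measure.dirac 0) ≤ cpLaw lam := by
  refine le_trans (le_of_eq ?_) (Measure.le_sum _ 0)
  simp [cpPow]

end CompoundPoisson

section Existence

lemma levy_zero {B : Type*} [NormedAddCommGroup B] [NormedSpace ℝ B] (L : B →L[ℝ] ℝ) :
    levyIntegrand L 0 = 0 := by
  simp [levyIntegrand]

lemma levy_meas {B : Type*} [NormedAddCommGroup B] [NormedSpace ℝ B] [MeasurableSpace B]
    [OpensMeasurableSpace B] (L : B →L[ℝ] ℝ) : Measurable (levyIntegrand L) := by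
  unfold levyIntegrand
  have h : MeasurableSet {x : B | ‖x‖ ≤ 1} := measurableSet_le measurable_norm measurable_const
  fun_prop

lemma levy_bound {B : Type*} [NormedAddCommGroup B] [NormedSpace ℝ B] (L : B →L[ℝ] ℝ) (x : B) :
    ‖levyIntegrand L x‖ ≤ (3 * ‖L‖ ^ 2 + 2) * min 1 (‖x‖ ^ 2) := by
  have hexp : ‖Complex.exp (Complex.I * (L x : ℂ))‖ = 1 := by
    rw [mul_comm, Complex.norm_exp_ofReal_mul_I]
  have hn : ‖Complex.I * (L x : ℂ)‖ = |L x| := by simp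
  by_cases hx : ‖x‖ ≤ 1
  · have e : levyIntegrand L x = Complex.exp (Complex.I * (L x : ℂ)) - 1 - Complex.I * (L x : ℂ) := by
      simp [levyIntegrand, hx]
    have hmin : min 1 (‖x‖ ^ 2) = ‖x‖ ^ 2 := min_eq_right (by nlinarith [norm_nonneg x])
    have h1 : ‖levyIntegrand L x‖ ≤ 3 * |L x| ^ 2 := by
      rw [e]
      by_cases hL : |L x| ≤ 1
      · have := Complex.norm_exp_sub_one_sub_id_le (x := Complex.I * (L x : ℂ)) (by rw [hn]; exact hL)
        rw [hn] at this
        nlinarith [sq_nonneg |L x|]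
      · refine (norm_sub_le _ _).trans ?_
        have := norm_sub_le (Complex.exp (Complex.I * (L x : ℂ))) 1
        rw [hexp, norm_one] at this
        rw [hn]
        push Not at hL
        nlinarith
    have h2 : |L x| ≤ ‖L‖ * ‖x‖ := L.le_opNorm x
    have h3 : |L x| ^ 2 ≤ (‖L‖ * ‖x‖) ^ 2 := by gcongr
    rw [hmin]
    nlinarith [sq_nonneg ‖x‖]
  · have e : levyIntegrand L x = Complex.exp (Complex.I * (L x : ℂ)) - 1 := by
      simp [levyIntegrand, hx]
    push Not at hx
    have hmin : min 1 (‖x‖ ^ 2) = 1 := min_eq_left (by nlinarith [norm_nonneg x])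
    have := norm_sub_le (Complex.exp (Complex.I * (L x : ℂ))) 1
    rw [hexp, norm_one] at this
    rw [hmin, e]
    nlinarith [sq_nonneg ‖L‖]

variable {E : Type*} [NormedAddCommGroup E] [InnerProductSpace ℝ E] [FiniteDimensional ℝ E]
  [MeasurableSpace E] [BorelSpace E]

lemma levy_min_integrable {F : Measure E}
    (hF : ∫⁻ x, ENNReal.ofReal (min 1 (‖x‖ ^ 2)) ∂F < ⊤) :
    Integrable (fun x : E => min 1 (‖x‖ ^ 2)) F := by
  refine ⟨Measurable.aestronglyMeasurable (by fun_prop), ?_⟩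
  rw [hasFiniteIntegral_iff_ofReal (ae_of_all _ fun x => by positivity)]
  exact hF

lemma levy_integrable_of_min {F : Measure E}
    (hF : ∫⁻ x, ENNReal.ofReal (min 1 (‖x‖ ^ 2)) ∂F < ⊤) (L : E →L[ℝ] ℝ) :
    Integrable (levyIntegrand L) F := by
  refine ((levy_min_integrable hF).const_mul (3 * ‖L‖ ^ 2 + 2)).mono'
    (levy_meas L).aestronglyMeasurable (ae_of_all _ (levy_bound L))

lemma levy_exists {F : Measure E}
    (hF : ∫⁻ x, ENNReal.ofReal (min 1 (‖x‖ ^ 2)) ∂F < ⊤) :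
    ∃ μ : Measure E, IsProbabilityMeasure μ ∧ ∀ L : E →L[ℝ] ℝ,
      charFunDual μ L = Complex.exp (∫ x, levyIntegrand L x ∂F) := by
  have hIntg := levy_integrable_of_min hF
  let S : ℕ → Set E := fun n => {x | 1 / ((n : ℝ) + 1) < ‖x‖}
  have hSm : ∀ n, MeasurableSet (S n) := fun n => measurableSet_lt measurable_const measurable_norm
  have hSfin : ∀ n, F (S n) < ⊤ := by
    intro n
    have hε : (0 : ℝ) < min 1 ((1 / ((n : ℝ) + 1)) ^ 2) := by positivity
    have := meas_ge_le_lintegral_div (μ := F) (f := fun x => ENNReal.ofReal (min 1 (‖x‖ ^ 2)))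
      (Measurable.aemeasurable (by fun_prop)) (ε := ENNReal.ofReal (min 1 ((1 / ((n : ℝ) + 1)) ^ 2)))
      (ENNReal.ofReal_pos.mpr hε).ne' ENNReal.ofReal_ne_top
    refine lt_of_le_of_lt (measure_mono ?_) (lt_of_le_of_lt this
      (ENNReal.div_lt_top hF.ne (ENNReal.ofReal_pos.mpr hε).ne'))
    intro x hx
    apply ENNReal.ofReal_le_ofReal
    have hx' : 1 / ((n : ℝ) + 1) < ‖x‖ := hx
    gcongr
  have hfin : ∀ n, IsFiniteMeasure (F.restrict (S n)) := fun n => ⟨by simpa using hSfin n⟩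
  let b : Set E := {x | ‖x‖ ≤ 1}
  have hb : MeasurableSet b := measurableSet_le measurable_norm measurable_const
  let v : ℕ → E := fun n => - ∫ x, b.indicator (fun x => x) x ∂(F.restrict (S n))
  let m : ℕ → Measure E := fun n => (cpLaw (F.restrict (S n))).map (fun x => x + v n)
  have hmp : ∀ n, IsProbabilityMeasure (m n) := fun n =>
    Measure.isProbabilityMeasure_map (by fun_prop)
  have hmchar : ∀ n (L : E →L[ℝ] ℝ), charFunDual (m n) L =
      Complex.exp (∫ x in S n, levyIntegrand L x ∂F) := by
    intro n L
    have hi1 : Integrable (b.indicator (fun x => x)) (F.restrict (S n)) := by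
      refine (integrable_const (1 : ℝ)).mono
        ((measurable_id.indicator hb).aestronglyMeasurable) (ae_of_all _ fun x => ?_)
      by_cases hx : x ∈ b
      · have hx' : ‖x‖ ≤ 1 := hx
        rw [Set.indicator_of_mem hx]; simpa using hx'
      · rw [Set.indicator_of_notMem hx]; simp
    have hi2 : Integrable (fun x => L (b.indicator (fun x => x) x)) (F.restrict (S n)) :=
      L.integrable_comp hi1
    have hLv : L (v n) = - ∫ x, L (b.indicator (fun x => x) x) ∂(F.restrict (S n)) := by
      rw [map_neg, L.integral_comp_comm hi1]
    have hi4 : Integrable (fun x => ((L (b.indicator (fun x => x) x) : ℝ) : ℂ) * Complex.I)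
        (F.restrict (S n)) := hi2.ofReal.mul_const _
    have hi3 : Integrable (fun x => Complex.exp (Complex.I * (L x : ℂ)) - 1) (F.restrict (S n)) := by
      refine Integrable.sub ?_ (integrable_const _)
      refine (integrable_const (1 : ℝ)).mono (Measurable.aestronglyMeasurable (by fun_prop)) ?_
      refine ae_of_all _ fun y => ?_
      rw [mul_comm, Complex.norm_exp_ofReal_mul_I]; simp
    rw [charFunDual_map_add_const, cpLaw_char, ← Complex.exp_add, hLv]
    congr 1
    rw [Complex.ofReal_neg, neg_mul, ← sub_eq_add_neg, ← integral_complex_ofReal, ← integral_mul_const,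
      ← integral_sub hi3 hi4]
    refine integral_congr_ae (ae_of_all _ fun x => ?_)
    by_cases hx : ‖x‖ ≤ 1
    · have : x ∈ b := hx
      simp [levyIntegrand, hx, this, mul_comm]
    · have : x ∉ b := hx
      simp [levyIntegrand, hx, this]
  have htend : ∀ L : E →L[ℝ] ℝ, Tendsto (fun n => charFunDual (m n) L) atTop
      (𝓝 (Complex.exp (∫ x, levyIntegrand L x ∂F))) := by
    intro L
    simp_rw [hmchar]
    refine (Complex.continuous_exp.tendsto _).comp ?_
    have hmono : Monotone S := by
      intro i j hij x hx
      have hx' : 1 / ((i : ℝ) + 1) < ‖x‖ := hx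
      refine lt_of_le_of_lt ?_ hx'
      have : (i : ℝ) ≤ j := by exact_mod_cast hij
      gcongr
    have h := tendsto_setIntegral_of_monotone hSm hmono (hIntg L).integrableOn
    have e : ∫ x in ⋃ n, S n, levyIntegrand L x ∂F = ∫ x, levyIntegrand L x ∂F := by
      refine setIntegral_eq_integral_of_forall_compl_eq_zero fun x hx => ?_
      have : x = 0 := by
        by_contra h0
        apply hx
        obtain ⟨n, hn⟩ := exists_nat_one_div_lt (norm_pos_iff.mpr h0)
        exact Set.mem_iUnion.mpr ⟨n, hn⟩
      rw [this, levy_zero]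
    rwa [e] at h
  let f : E → ℂ := fun t => Complex.exp (∫ x, levyIntegrand (InnerProductSpace.toDualMap ℝ E t) x ∂F)
  have hf : ContinuousAt f 0 := by
    refine (Complex.continuous_exp.continuousAt).comp ?_
    refine continuousAt_of_dominated (bound := fun x => 5 * min 1 (‖x‖ ^ 2))
      (Eventually.of_forall fun t => (levy_meas _).aestronglyMeasurable) ?_
      ((levy_min_integrable hF).const_mul 5) (ae_of_all _ fun x => ?_)
    · filter_upwards [Metric.ball_mem_nhds (0 : E) one_pos] with t ht
      refine ae_of_all _ fun x => (levy_bound _ x).trans ?_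
      have h1 : ‖t‖ < 1 := by simpa using ht
      have h2 : ‖InnerProductSpace.toDualMap ℝ E t‖ = ‖t‖ := by simp
      rw [h2]
      have : 3 * ‖t‖ ^ 2 + 2 ≤ 5 := by nlinarith [norm_nonneg t]
      gcongr
    · unfold levyIntegrand
      simp only [InnerProductSpace.toDualMap_apply_apply]
      fun_prop
  have hcf : ∀ t : E, Tendsto (fun n => charFun (m n) t) atTop (𝓝 (f t)) := by
    intro t
    simp_rw [charFun_eq_charFunDual_toDualMap]
    exact htend _
  have htight := isTightMeasureSet_of_tendsto_charFun hf hcf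
  let p : ℕ → ProbabilityMeasure E := fun n => ⟨m n, hmp n⟩
  have hcomp : IsCompact (closure (Set.range p)) := by
    apply isCompact_closure_of_isTightMeasureSet
    refine htight.subset ?_
    rintro _ ⟨_, ⟨n, rfl⟩, rfl⟩
    exact ⟨n, rfl⟩
  have hpu : p ⁻¹' Set.range p ∈ hyperfilter ℕ := by
    have : p ⁻¹' Set.range p = Set.univ := by ext n; simp
    rw [this]
    exact Filter.univ_mem
  obtain ⟨μ, -, hμ⟩ := hcomp.ultrafilter_le_nhds ((hyperfilter ℕ).map p)
    (le_principal_iff.mpr (mem_of_superset (Ultrafilter.mem_map.mpr hpu) subset_closure))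
  have hμ' : Tendsto p (hyperfilter ℕ : Filter ℕ) (𝓝 μ) := hμ
  refine ⟨μ, inferInstance, fun L => ?_⟩
  have h1 : Tendsto (fun n => charFunDual (m n) L) (hyperfilter ℕ : Filter ℕ) (𝓝 (charFunDual (μ : Measure E) L)) := by
    rw [ProbabilityMeasure.tendsto_iff_forall_integral_rclike_tendsto ℂ] at hμ'
    exact hμ' (BoundedContinuousFunction.probCharDual L)
  exact tendsto_nhds_unique h1 ((htend L).mono_left (Nat.hyperfilter_le_atTop))

end Existence

section Reflection

open ProbabilityTheory

lemma conv_mono_meas {E : Type*} [NormedAddCommGroup E] [MeasurableSpace E] [BorelSpace E]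
    [SecondCountableTopology E] {μ μ' ν ν' : Measure E} [SFinite ν] [SFinite ν']
    (h : μ ≤ μ') (h' : ν ≤ ν') : μ ∗ ν ≤ μ' ∗ ν' := by
  refine Measure.le_iff.mpr fun s hs => ?_
  rw [← lintegral_indicator_one hs, ← lintegral_indicator_one hs,
    Measure.lintegral_conv (measurable_one.indicator hs),
    Measure.lintegral_conv (measurable_one.indicator hs)]
  exact lintegral_mono' h fun x => lintegral_mono' h' le_rfl

lemma charFunDual_neg_map {B : Type*} [NormedAddCommGroup B] [NormedSpace ℝ B] [MeasurableSpace B]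
    [BorelSpace B] (μ : Measure B) (L : StrongDual ℝ B) :
    charFunDual (μ.map Neg.neg) L = charFunDual μ (-L) := by
  rw [charFunDual_apply, charFunDual_apply, integral_map (by fun_prop) (by fun_prop)]
  simp

lemma levy_add_neg {B : Type*} [NormedAddCommGroup B] [NormedSpace ℝ B] (L : B →L[ℝ] ℝ) (x : B) :
    levyIntegrand L x + levyIntegrand (-L) x = ((2 * (Real.cos (L x) - 1) : ℝ) : ℂ) := by
  simp only [levyIntegrand, neg_apply]
  push_cast
  rw [Complex.cos, mul_comm Complex.I, mul_comm Complex.I]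
  ring

lemma symm_char {B : Type*} [NormedAddCommGroup B] [NormedSpace ℝ B] [MeasurableSpace B]
    [BorelSpace B] [SecondCountableTopology B] {μ ν : Measure B} [IsProbabilityMeasure μ]
    (hi : ∀ L : B →L[ℝ] ℝ, Integrable (levyIntegrand L) ν)
    (hc : ∀ L : B →L[ℝ] ℝ, charFunDual μ L = Complex.exp (∫ x, levyIntegrand L x ∂ν))
    (L : B →L[ℝ] ℝ) :
    charFunDual (μ ∗ μ.map Neg.neg) L =
      Complex.exp ((∫ x, 2 * (Real.cos (L x) - 1) ∂ν : ℝ) : ℂ) := by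
  have := Measure.isProbabilityMeasure_map (μ := μ) (f := (Neg.neg : B → B)) (by fun_prop)
  rw [charFunDual_conv, charFunDual_neg_map, hc, hc, ← Complex.exp_add,
    ← integral_add (hi _) (hi _), ← integral_complex_ofReal]
  simp_rw [levy_add_neg]

lemma cp_symm_char {B : Type*} [NormedAddCommGroup B] [NormedSpace ℝ B] [MeasurableSpace B]
    [BorelSpace B] [SecondCountableTopology B] (lam : Measure B) [IsFiniteMeasure lam]
    (L : B →L[ℝ] ℝ) :
    charFunDual (cpLaw lam) L * charFunDual ((cpLaw lam).map Neg.neg) L =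
      Complex.exp ((∫ x, 2 * (Real.cos (L x) - 1) ∂lam : ℝ) : ℂ) := by
  have hi : ∀ L : B →L[ℝ] ℝ,
      Integrable (fun x => Complex.exp (Complex.I * (L x : ℂ)) - 1) lam := by
    intro L
    refine Integrable.sub ?_ (integrable_const _)
    refine (integrable_const (1 : ℝ)).mono (Measurable.aestronglyMeasurable (by fun_prop)) ?_
    refine ae_of_all _ fun y => ?_
    rw [mul_comm, Complex.norm_exp_ofReal_mul_I]; simp
  rw [charFunDual_neg_map, cpLaw_char, cpLaw_char, ← Complex.exp_add,
    ← integral_add (hi _) (hi _), ← integral_complex_ofReal]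
  congr 2
  funext x
  simp only [neg_apply]
  push_cast
  rw [Complex.cos, mul_comm Complex.I, mul_comm Complex.I]
  ring

variable {E : Type*} [NormedAddCommGroup E] [InnerProductSpace ℝ E] [FiniteDimensional ℝ E]
  [MeasurableSpace E] [BorelSpace E]

lemma symm_half {ζ lam : Measure E} [IsProbabilityMeasure ζ] [IsProbabilityMeasure lam]
    (hζ : ζ.map Neg.neg = ζ) {A : Set E} (hA : MeasurableSet A) (hlam : lam Aᶜ = 0)
    (hr : ∀ y z : E, y ∈ A → y + z ∈ A ∨ y - z ∈ A) :
    1 / 2 ≤ (lam ∗ ζ) A := by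
  rw [← lintegral_indicator_one hA, Measure.lintegral_conv (measurable_one.indicator hA)]
  calc (1 / 2 : ℝ≥0∞) = ∫⁻ _, 1 / 2 ∂lam := by simp
    _ ≤ _ := by
      refine lintegral_mono_ae ?_
      have : ∀ᵐ x ∂lam, x ∈ A := by rw [ae_iff]; exact hlam
      filter_upwards [this] with x hx
      have e1 : ∫⁻ y, A.indicator 1 (x + y) ∂ζ = ∫⁻ y, A.indicator (1 : E → ℝ≥0∞) (x - y) ∂ζ := by
        conv_lhs => rw [← hζ]
        rw [lintegral_map (by exact (measurable_one.indicator hA).comp (measurable_const_add x)) measurable_neg]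
        simp [sub_eq_add_neg]
      have e2 : (1 : ℝ≥0∞) ≤ ∫⁻ y, A.indicator 1 (x + y) ∂ζ + ∫⁻ y, A.indicator (1 : E → ℝ≥0∞) (x - y) ∂ζ := by
        rw [← lintegral_add_left (by exact (measurable_one.indicator hA).comp (measurable_const_add x))]
        calc (1 : ℝ≥0∞) = ∫⁻ _, 1 ∂ζ := by simp
          _ ≤ _ := by
            refine lintegral_mono fun y => ?_
            rcases hr x y hx with h | h
            · simp [h]
            · simp [h]
      rw [← e1, ← two_mul] at e2
      exact ENNReal.div_le_of_le_mul' e2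

lemma reflection {G ρ : Measure E} [IsFiniteMeasure ρ]
    (hG : ∫⁻ x, ENNReal.ofReal (min 1 (‖x‖ ^ 2)) ∂G < ⊤)
    (hρ : ∀ L : E →L[ℝ] ℝ, charFunDual ρ L =
      Complex.exp ((∫ x, 2 * (Real.cos (L x) - 1) ∂G : ℝ) : ℂ))
    {A : Set E} (hA : MeasurableSet A)
    (hr : ∀ y z : E, y ∈ A → y + z ∈ A ∨ y - z ∈ A)
    (hGA : G A < ⊤) (h1 : 1 ≤ G A) :
    ENNReal.ofReal (Real.exp (-1)) * (ENNReal.ofReal (Real.exp (-1)) * (1 / 2)) ≤ ρ A := by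
  set c : ℝ≥0∞ := (G A)⁻¹ with hc
  have hc1 : c ≤ 1 := ENNReal.inv_le_one.mpr h1
  have h0 : G A ≠ 0 := (lt_of_lt_of_le zero_lt_one h1).ne'
  set lam := c • G.restrict A with hlam
  set H := (1 - c) • G.restrict A + G.restrict Aᶜ with hH
  have hsum : lam + H = G := by
    rw [hlam, hH, ← add_assoc, ← add_smul, add_tsub_cancel_of_le hc1, one_smul,
      Measure.restrict_add_restrict_compl hA]
  have hlp : IsProbabilityMeasure lam := ⟨by
    simp [hlam, hc, ENNReal.inv_mul_cancel h0 hGA.ne]⟩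
  have hHle : H ≤ G := by
    rw [← hsum]; exact Measure.le_add_left le_rfl
  have hlle : lam ≤ G := by
    rw [← hsum]; exact Measure.le_add_right le_rfl
  have hHfin : ∫⁻ x, ENNReal.ofReal (min 1 (‖x‖ ^ 2)) ∂H < ⊤ :=
    lt_of_le_of_lt (lintegral_mono' hHle le_rfl) hG
  obtain ⟨ζ0, hζ0, hζc⟩ := levy_exists hHfin
  have hn0 := Measure.isProbabilityMeasure_map (μ := ζ0) (f := (Neg.neg : E → E)) (by fun_prop)
  set ζ := ζ0 ∗ ζ0.map Neg.neg with hζ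
  have hζp : IsProbabilityMeasure ζ := by rw [hζ]; infer_instance
  have hnζ := Measure.isProbabilityMeasure_map (μ := ζ) (f := (Neg.neg : E → E)) (by fun_prop)
  have hζch := symm_char (levy_integrable_of_min hHfin) hζc
  have hζs : ζ.map Neg.neg = ζ := by
    refine Measure.ext_of_charFunDual (funext fun L => ?_)
    rw [charFunDual_neg_map, hζch, hζch]
    simp
  set e := cpLaw lam with he
  have hne := Measure.isProbabilityMeasure_map (μ := e) (f := (Neg.neg : E → E)) (by fun_prop)
  have hci : ∀ L : E →L[ℝ] ℝ, Integrable (fun x => 2 * (Real.cos (L x) - 1)) G := by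
    intro L
    have := (levy_integrable_of_min hG L).re
    refine (this.const_mul 2).congr (ae_of_all _ fun x => ?_)
    simp [levy_re]
  have hρe : ρ = e ∗ (e.map Neg.neg ∗ ζ) := by
    refine Measure.ext_of_charFunDual (funext fun L => ?_)
    rw [charFunDual_conv, charFunDual_conv, ← mul_assoc, he, cp_symm_char, hζch, hρ,
      ← Complex.exp_add, ← Complex.ofReal_add, ← integral_add_measure ((hci L).mono_measure hlle)
      ((hci L).mono_measure hHle), hsum]
  have hl1 : lam.real Set.univ = 1 := by simp
  have g1 : ENNReal.ofReal (Real.exp (-1)) • lam ≤ e := by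
    have := cpLaw_ge_self lam
    rwa [hl1, Measure.conv_dirac_zero] at this
  have g2 : ENNReal.ofReal (Real.exp (-1)) • ζ ≤ e.map Neg.neg ∗ ζ := by
    have h := Measure.map_mono (cpLaw_ge_dirac lam) (measurable_neg (G := E))
    rw [hl1, Measure.map_smul, Measure.map_dirac' measurable_neg, neg_zero] at h
    have := conv_mono_meas h (le_refl ζ)
    rwa [Measure.conv_smul_left, Measure.dirac_zero_conv] at this
  have hfs : IsFiniteMeasure (ENNReal.ofReal (Real.exp (-1)) • ζ) :=
    Measure.smul_finite _ ENNReal.ofReal_ne_top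
  have g3 := conv_mono_meas g1 g2
  rw [Measure.conv_smul_left, Measure.conv_smul_right, ← hρe] at g3
  have hlA : lam Aᶜ = 0 := by simp [hlam, hA]
  refine le_trans ?_ (g3 A)
  rw [Measure.smul_apply, Measure.smul_apply, smul_eq_mul, smul_eq_mul]
  gcongr
  exact symm_half hζs hA hlA hr

end Reflection

section Tail

lemma min_sq_le_sum {n : ℕ} (x : EuclideanSpace ℝ (Fin n)) :
    ENNReal.ofReal (min 1 (‖x‖ ^ 2)) ≤ ∑ i, ENNReal.ofReal (min 1 ((x i) ^ 2)) := by
  rw [← ENNReal.ofReal_sum_of_nonneg (fun i _ => by positivity)]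
  apply ENNReal.ofReal_le_ofReal
  rw [EuclideanSpace.norm_sq_eq]
  by_cases h : ∃ i, 1 ≤ (x i) ^ 2
  · obtain ⟨i, hi⟩ := h
    refine (min_le_left _ _).trans ?_
    have := Finset.single_le_sum (f := fun i => min 1 ((x i) ^ 2)) (fun i _ => by positivity)
      (Finset.mem_univ i)
    simpa [hi] using this
  · push Not at h
    refine (min_le_right _ _).trans (Finset.sum_le_sum fun i _ => ?_)
    rw [min_eq_right (h i).le]
    simp

variable {B : Type*} [NormedAddCommGroup B] [NormedSpace ℝ B] [CompleteSpace B]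
  [SecondCountableTopology B] [MeasurableSpace B] [BorelSpace B]

lemma levy_compact {ν μ : Measure B} [IsProbabilityMeasure μ]
    (h : ∀ L : B →L[ℝ] ℝ, Integrable (levyIntegrand L) ν ∧
      ∫ y, Complex.exp (Complex.I * (L y : ℂ)) ∂μ = Complex.exp (∫ x, levyIntegrand L x ∂ν)) :
    ∃ K : Set B, IsCompact K ∧ ν Kᶜ ≤ 1 := by
  have hn := Measure.isProbabilityMeasure_map (μ := μ) (f := (Neg.neg : B → B)) (by fun_prop)
  have hch := symm_char (μ := μ) (ν := ν) (fun L => (h L).1) (fun L => by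
    rw [charFunDual_apply, ← (h L).2]; simp_rw [mul_comm])
  set ρ := μ ∗ μ.map Neg.neg with hρ
  have hρp : IsProbabilityMeasure ρ := by rw [hρ]; infer_instance
  set k : ℝ≥0∞ := ENNReal.ofReal (Real.exp (-1)) * (ENNReal.ofReal (Real.exp (-1)) * (1 / 2)) with hk
  have hkpos : 0 < k := by
    have : 0 < ENNReal.ofReal (Real.exp (-1)) := ENNReal.ofReal_pos.mpr (Real.exp_pos _)
    exact ENNReal.mul_pos this.ne' (ENNReal.mul_pos this.ne' (by simp)).ne'
  obtain ⟨k', hk'0, hk'⟩ := exists_between hkpos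
  obtain ⟨K0, hK0, hK0ρ⟩ := (isTightMeasureSet_iff_exists_isCompact_measure_compl_le.mp
    (isTightMeasureSet_singleton (μ := ρ))) k' hk'0
  have hK0' : ρ K0ᶜ < k := lt_of_le_of_lt (hK0ρ ρ rfl) hk'
  let K : Set B := closedAbsConvexHull ℝ (insert 0 K0)
  have hKc : IsCompact K := isCompact_closedAbsConvexHull_of_totallyBounded
    (hK0.insert 0).totallyBounded
  have hKK : insert 0 K0 ⊆ K := subset_closedAbsConvexHull
  have hKa : AbsConvex ℝ K := by
    change AbsConvex ℝ (closedAbsConvexHull ℝ (insert 0 K0))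
    rw [closedAbsConvexHull_eq_closure_absConvexHull]
    exact absConvex_absConvexHull.closure
  have hKcl : IsClosed K := hKc.isClosed
  refine ⟨K, hKc, ?_⟩
  let S : Type _ := {L : B →L[ℝ] ℝ // ∀ x ∈ K, |L x| ≤ 1}
  have hop : ∀ L : S, IsOpen {x : B | 1 < |L.1 x|} := fun L =>
    isOpen_lt continuous_const (continuous_abs.comp (Subtype.val L).continuous)
  obtain ⟨T, hT, hTU⟩ := TopologicalSpace.isOpen_iUnion_countable _ hop
  let z : S := ⟨0, by simp⟩
  obtain ⟨f, hf⟩ := (hT.insert z).exists_eq_range ⟨z, Set.mem_insert _ _⟩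
  have hcov : Kᶜ ⊆ ⋃ n, {x : B | 1 < |(f n).1 x|} := by
    intro x hx
    obtain ⟨g, u, hg, hu⟩ := geometric_hahn_banach_closed_point hKa.2 hKcl hx
    have hu0 : 0 < u := by simpa using hg 0 (hKK (Set.mem_insert _ _))
    let L : S := ⟨u⁻¹ • g, by
      intro y hy
      have h1 := hg y hy
      have h2 := hg (-y) (hKa.1.neg_mem_iff.mpr hy)
      rw [map_neg] at h2
      have h3 : |g y| ≤ u := abs_le.mpr ⟨by linarith, h1.le⟩
      simp only [smul_apply, smul_eq_mul, abs_mul, abs_inv, abs_of_pos hu0]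
      rw [inv_mul_le_iff₀ hu0]
      simpa using h3⟩
    have hx2 : x ∈ ⋃ L : S, {x : B | 1 < |L.1 x|} := by
      refine Set.mem_iUnion.mpr ⟨L, ?_⟩
      change 1 < |u⁻¹ * g x|
      refine lt_of_lt_of_le ?_ (le_abs_self _)
      rw [lt_inv_mul_iff₀ hu0]
      simpa using hu
    rw [← hTU] at hx2
    obtain ⟨L', hL', hxL'⟩ := Set.mem_iUnion₂.mp hx2
    have : L' ∈ Set.range f := hf ▸ Set.mem_insert_of_mem _ hL'
    obtain ⟨n, rfl⟩ := this
    exact Set.mem_iUnion.mpr ⟨n, hxL'⟩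
  let U : ℕ → Set B := fun n => {x | ∃ i : Fin n, 1 < |(f i).1 x|}
  have hUm : Monotone U := by
    rintro a b hab x ⟨i, hi⟩
    exact ⟨Fin.castLE hab i, hi⟩
  have hU1 : ∀ n, ν (U n) ≤ 1 := by
    intro n
    let π : B →L[ℝ] EuclideanSpace ℝ (Fin n) :=
      ((EuclideanSpace.equiv (Fin n) ℝ).symm : (Fin n → ℝ) →L[ℝ] EuclideanSpace ℝ (Fin n)).comp
        (ContinuousLinearMap.pi fun i : Fin n => (f i).1)
    have hπ : ∀ x i, π x i = (f i).1 x := fun x i => by simp [π]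
    let A : Set (EuclideanSpace ℝ (Fin n)) := {x | ∃ i, 1 < |x i|}
    have hA : MeasurableSet A := by
      have : A = ⋃ i, {x | 1 < |x i|} := by ext x; simp [A]
      rw [this]
      exact MeasurableSet.iUnion fun i =>
        (isOpen_lt continuous_const (by fun_prop)).measurableSet
    have hpre : π ⁻¹' A = U n := by
      ext x; simp [A, U, hπ]
    have hGA : (ν.map π) A = ν (U n) := by
      rw [Measure.map_apply π.continuous.measurable hA, hpre]
    have hρA : (ρ.map π) A = ρ (U n) := by
      rw [Measure.map_apply π.continuous.measurable hA, hpre]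
    have hUK : U n ⊆ K0ᶜ := by
      rintro x ⟨i, hi⟩ hx
      exact absurd ((f i).2 x (hKK (Set.mem_insert_of_mem _ hx))) (not_le.mpr hi)
    have hGm : ∫⁻ x, ENNReal.ofReal (min 1 (‖x‖ ^ 2)) ∂(ν.map π) < ⊤ := by
      rw [lintegral_map (by fun_prop) π.continuous.measurable]
      refine lt_of_le_of_lt (lintegral_mono fun x => min_sq_le_sum (π x)) ?_
      rw [lintegral_finsetSum _ (fun i _ => by fun_prop)]
      refine ENNReal.sum_lt_top.mpr fun i _ => ?_
      simp_rw [hπ]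
      exact levy_one_dim h (f i).1
    have hfin : ν (U n) < ⊤ := by
      have : U n ⊆ ⋃ i : Fin n, {x | 1 ≤ |(f i).1 x|} := by
        rintro x ⟨i, hi⟩
        exact Set.mem_iUnion.mpr ⟨i, le_of_lt hi⟩
      refine lt_of_le_of_lt (measure_mono this) (lt_of_le_of_lt (measure_iUnion_le _) ?_)
      rw [tsum_fintype]
      exact ENNReal.sum_lt_top.mpr fun i _ => levy_half_fin h (f i).1 one_pos
    by_contra hcon
    push Not at hcon
    have hρf : IsFiniteMeasure (ρ.map π) := by infer_instance
    have key := reflection (G := ν.map π) (ρ := ρ.map π) hGm (fun L => by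
      rw [charFunDual_map, hch, integral_map π.continuous.measurable.aemeasurable
        (by fun_prop)]
      simp) hA (by
      rintro y w ⟨i, hi⟩
      by_contra hno
      simp only [A, Set.mem_ofPred_eq, not_or, not_exists, not_lt] at hno
      have a := hno.1 i
      have b := hno.2 i
      simp only [PiLp.add_apply, PiLp.sub_apply] at a b
      have : |2 * y i| ≤ 2 := by
        have e : 2 * y i = (y i + w i) + (y i - w i) := by ring
        rw [e]
        exact (abs_add_le _ _).trans (by linarith)
      rw [abs_mul, abs_two] at this
      linarith) (hGA ▸ hfin) (hGA ▸ hcon.le)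
    rw [hρA] at key
    exact absurd (lt_of_le_of_lt (key.trans (measure_mono hUK)) hK0') (lt_irrefl _)
  have hsub : Kᶜ ⊆ ⋃ n, U n := by
    intro x hx
    obtain ⟨n, hn⟩ := Set.mem_iUnion.mp (hcov hx)
    exact Set.mem_iUnion.mpr ⟨n + 1, ⟨⟨n, Nat.lt_succ_self n⟩, hn⟩⟩
  refine (measure_mono hsub).trans ?_
  rw [hUm.measure_iUnion]
  exact iSup_le hU1

lemma levy_tail {ν μ : Measure B} [IsProbabilityMeasure μ]
    (h : ∀ L : B →L[ℝ] ℝ, Integrable (levyIntegrand L) ν ∧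
      ∫ y, Complex.exp (Complex.I * (L y : ℂ)) ∂μ = Complex.exp (∫ x, levyIntegrand L x ∂ν))
    {ε : ℝ} (hε : 0 < ε) : ν {z : B | ε ≤ ‖z‖} < ⊤ := by
  obtain ⟨K, hK, hνK⟩ := levy_compact h
  have hC : IsCompact (K ∩ {z : B | ε ≤ ‖z‖}) :=
    hK.inter_right (isClosed_le continuous_const continuous_norm)
  have h1 : ν (K ∩ {z : B | ε ≤ ‖z‖}) < ⊤ := by
    refine hC.measure_lt_top_of_nhdsWithin fun x hx => ?_
    obtain ⟨g, hg1, hg2⟩ := exists_dual_vector'' ℝ x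
    refine ⟨{y | ε / 2 ≤ |g y|}, mem_nhdsWithin_of_mem_nhds ?_, levy_half_fin h g (half_pos hε)⟩
    have hx2 : ε ≤ ‖x‖ := hx.2
    have hgx : ε / 2 < |g x| := by
      rw [hg2]
      simp only [RCLike.ofReal_real_eq_id, id_eq, abs_norm]
      linarith
    have : {y : B | ε / 2 < |g y|} ∈ 𝓝 x :=
      (isOpen_lt continuous_const (by fun_prop)).mem_nhds hgx
    exact mem_of_superset this fun y (hy : ε / 2 < |g y|) => (le_of_lt hy : ε / 2 ≤ |g y|)
  have h2 : {z : B | ε ≤ ‖z‖} ⊆ (K ∩ {z : B | ε ≤ ‖z‖}) ∪ Kᶜ := by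
    intro z hz
    by_cases hzK : z ∈ K
    · exact Or.inl ⟨hzK, hz⟩
    · exact Or.inr hzK
  refine lt_of_le_of_lt (measure_mono h2) (lt_of_le_of_lt (measure_union_le _ _) ?_)
  exact ENNReal.add_lt_top.mpr ⟨h1, lt_of_le_of_lt hνK ENNReal.one_lt_top⟩

end Tail

/-- Every Lévy measure `F` on a separable Banach space `B` satisfies, for
each `ε > 0`, `sup_{‖y*‖ ≤ 1} ∫ 1_{‖x‖≤1} |⟨x, y*⟩|² F(dx) < ∞` and
`F({z : ‖z‖ ≥ ε}) < ∞`. In particular, a measure `F` on `ℝ^d` with `F({0}) = 0` is a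
Lévy measure if and only if `∫ (1 ∧ ‖x‖²) F(dx) < ∞`. -/
theorem levyMeasure_integrability
    {B : Type*} [NormedAddCommGroup B] [NormedSpace ℝ B] [CompleteSpace B]
    [SecondCountableTopology B] [MeasurableSpace B] [BorelSpace B] :
    (∀ ν : Measure B, IsLevyMeasure ν → ∀ ε : ℝ, 0 < ε →
      (⨆ L : {L : B →L[ℝ] ℝ // ‖L‖ ≤ 1},
        ∫⁻ x in {x : B | ‖x‖ ≤ 1}, ENNReal.ofReal ((L.1 x) ^ 2) ∂ν) < ⊤ ∧
      ν {z : B | ε ≤ ‖z‖} < ⊤) ∧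
    (∀ (d : ℕ) (F : Measure (EuclideanSpace ℝ (Fin d))), F {0} = 0 →
      (IsLevyMeasure F ↔ ∫⁻ x, ENNReal.ofReal (min 1 (‖x‖ ^ 2)) ∂F < ⊤)) := by
  refine ⟨?_, ?_⟩
  · rintro ν ⟨-, μ, hμ, h⟩ ε hε
    exact ⟨levy_sup h, levy_tail h hε⟩
  · intro d F hF0
    constructor
    · rintro ⟨-, μ, hμ, h⟩
      refine lt_of_le_of_lt (lintegral_mono fun x => min_sq_le_sum x) ?_
      rw [lintegral_finsetSum _ (fun i _ => by fun_prop)]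
      refine ENNReal.sum_lt_top.mpr fun i _ => ?_
      exact levy_one_dim h (EuclideanSpace.proj i)
    · intro hF
      obtain ⟨μ, hμ, hc⟩ := levy_exists hF
      refine ⟨hF0, μ, hμ, fun L => ⟨levy_integrable_of_min hF L, ?_⟩⟩
      rw [← hc L, charFunDual_apply]
      simp_rw [mul_comm]
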